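/- arXiv:quant-ph/0506265 — 2 statements merged into one kernel-verified Lean document; each statement's English description precedes it below -/
import Mathlib

section
/- Let G be a finite group with generators g_1,...,g_k where g_1 is the identity, and let K be a proper subgroup of G. For 1 ≤ l ≤ k, let S_l be the set of l-tuples of distinct indices from {1,...,k}, and for u = (u_1,...,u_l) ∈ S_l let g_u = g_{u_1}···g_{u_l}. Let p = (l(l-1)+(k-l)(k-l-1))/(k(k-1)). Then the probability over a uniformly random u ∈ S_l that g_u ∉ K is at least (1-p)/2. -/
/-- The number of injective `r`-tuples `u` of indices in `S` whose product `g_u` maps `x` to a point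
other than `x₀`. -/
def missCount {G X ι : Type*} [Monoid G] [MulAction G X] [DecidableEq X] [DecidableEq ι]
    (g : ι → G) (x₀ : X) : ℕ → Finset ι → X → ℕ
  | 0, _, x => if x = x₀ then 0 else 1
  | r + 1, S, x => ∑ c ∈ S, missCount g x₀ r (S.erase c) (g c • x)

section MissCount

variable {G X ι : Type*} [Group G] [MulAction G X] [DecidableEq X] [DecidableEq ι]
  (g : ι → G) (x₀ : X)

lemma missCount_eq_card [Fintype ι] (r : ℕ) (S : Finset ι) (x : X) :
    missCount g x₀ r S x = Nat.card {u : Fin r → ι // (Function.Injective u ∧ ∀ i, u i ∈ S) ∧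
      (List.ofFn (fun i => g (u i))).prod • x ≠ x₀} := by
  induction r generalizing S x with
  | zero =>
    by_cases hx : x = x₀
    · simp [missCount, hx]
    · simp [missCount, hx, Function.injective_of_subsingleton]
  | succ r ih =>
    simp only [missCount, ih]
    rw [← Finset.sum_coe_sort S, ← Nat.card_sigma]
    refine Nat.card_congr
      { toFun := fun p => ⟨Fin.snoc (α := fun _ => ι) p.2.1 p.1.1, ?_⟩
        invFun := fun u => ⟨⟨u.1 (Fin.last r), u.2.1.2 _⟩, ⟨Fin.init u.1, ?_⟩⟩
        left_inv := ?_
        right_inv := ?_ }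
    · obtain ⟨⟨c, hc⟩, u, ⟨hu, huS⟩, hx⟩ := p
      refine ⟨⟨Fin.snoc_injective_iff.2 ⟨hu, ?_⟩, ?_⟩, ?_⟩
      · rintro ⟨i, hi⟩
        exact (Finset.mem_erase.1 (huS i)).1 hi
      · intro i
        refine Fin.lastCases ?_ (fun i => ?_) i
        · simpa using hc
        · simpa using (Finset.mem_erase.1 (huS i)).2
      · rw [List.ofFn_succ', List.prod_concat, mul_smul]
        simpa using hx
    · obtain ⟨u, ⟨hu, huS⟩, hx⟩ := u
      refine ⟨⟨hu.comp (Fin.castSucc_injective r), fun i => Finset.mem_erase.2 ⟨?_, huS _⟩⟩, ?_⟩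
      · exact fun h => (Fin.castSucc_lt_last i).ne (hu h)
      · rwa [List.ofFn_succ', List.prod_concat, mul_smul] at hx
    · rintro ⟨⟨c, hc⟩, u, hu⟩
      ext <;> simp
    · rintro ⟨u, hu⟩
      simp

lemma missCount_mono (r : ℕ) {S T : Finset ι} (h : S ⊆ T) (x : X) :
    missCount g x₀ r S x ≤ missCount g x₀ r T x := by
  induction r generalizing S T x with
  | zero => simp [missCount]
  | succ r ih =>
    exact (Finset.sum_le_sum fun c _ => ih (Finset.erase_subset_erase c h) _).trans
      (Finset.sum_le_sum_of_subset h)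

lemma mul_pred_descFactorial (s r : ℕ) :
    s * (s - 1).descFactorial r = s.descFactorial (r + 1) := by
  cases s with
  | zero => simp
  | succ s => rw [Nat.succ_descFactorial_succ, Nat.add_sub_cancel]

/-- An injective tuple cannot bring two distinct points to `x₀`. -/
lemma descFactorial_le_missCount_add (r : ℕ) (S : Finset ι) {x y : X} (h : x ≠ y) :
    S.card.descFactorial r ≤ missCount g x₀ r S x + missCount g x₀ r S y := by
  induction r generalizing S x y with
  | zero =>
    simp only [missCount, Nat.descFactorial_zero]
    split_ifs with hx hy <;> simp_all
  | succ r ih =>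
    simp only [missCount]
    rw [← Finset.sum_add_distrib, ← mul_pred_descFactorial, ← smul_eq_mul]
    refine Finset.card_nsmul_le_sum _ _ _ fun c hc => ?_
    rw [← Finset.card_erase_of_mem hc]
    exact ih _ (by simpa using h)

lemma missCount_eq_descFactorial (r : ℕ) (S : Finset ι) {x : X} (hx : x ≠ x₀)
    (hS : ∀ c ∈ S, g c • x = x) :
    missCount g x₀ r S x = S.card.descFactorial r := by
  induction r generalizing S with
  | zero => simp [missCount, hx]
  | succ r ih =>
    rw [← mul_pred_descFactorial, missCount, ← smul_eq_mul]
    refine Finset.sum_eq_card_nsmul fun c hc => ?_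
    rw [hS c hc, ih _ fun d hd => hS d (Finset.mem_of_mem_erase hd), Finset.card_erase_of_mem hc]

/-- Choice of the index to be exchanged with the identity. -/
lemma exists_moving_index {S : Finset ι} {x : X} (h : x ≠ x₀ ∨ ∃ c ∈ S, g c • x₀ ≠ x₀) :
    (x ≠ x₀ ∧ ∀ c ∈ S, g c • x = x) ∨
      ∃ j ∈ S, g j • x ≠ x ∧ ∀ c ∈ S, c ≠ j →
        (g c • x ≠ x₀ ∨ ∃ d ∈ S.erase c, g d • x₀ ≠ x₀) := by
  by_cases hj : ∃ j ∈ S, g j • x ≠ x ∧ g j • x₀ ≠ x₀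
  · obtain ⟨j, hjS, hjx, hj₀⟩ := hj
    exact .inr ⟨j, hjS, hjx, fun c _ hcj =>
      .inr ⟨j, Finset.mem_erase.2 ⟨hcj.symm, hjS⟩, hj₀⟩⟩
  push Not at hj
  have hx : x ≠ x₀ := by
    rintro rfl
    obtain h | ⟨c, hc, hcx⟩ := h
    · exact h rfl
    · exact hcx (hj c hc hcx)
  by_cases hfix : ∀ c ∈ S, g c • x = x
  · exact .inl ⟨hx, hfix⟩
  push Not at hfix
  obtain ⟨j, hjS, hjx⟩ := hfix
  refine .inr ⟨j, hjS, hjx, fun c hc _ => .inl fun hcx => ?_⟩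
  by_cases hc' : g c • x = x
  · exact hx (hc'.symm.trans hcx)
  · exact hx (smul_left_cancel (g c) (hcx.trans (hj c hc hc').symm))

lemma mul_descFactorial_le_missCount {e : ι} (he : g e = 1) (r : ℕ) {S : Finset ι} (heS : e ∈ S)
    {x : X} (h : x ≠ x₀ ∨ ∃ c ∈ S, g c • x₀ ≠ x₀) :
    r * (S.card - 2).descFactorial (r - 1) ≤ missCount g x₀ r S x := by
  induction r generalizing S x with
  | zero => simp
  | succ r ih =>
    have hpos : 0 < S.card := Finset.card_pos.2 ⟨e, heS⟩
    rw [Nat.add_sub_cancel]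
    obtain ⟨hx, hfix⟩ | ⟨j, hjS, hjx, hc⟩ := exists_moving_index g x₀ h
    · rw [missCount_eq_descFactorial g x₀ _ S hx hfix, ← mul_pred_descFactorial]
      obtain hr | hr := le_or_gt (r + 1) S.card
      · exact Nat.mul_le_mul hr (Nat.descFactorial_le _ (by omega))
      · rw [Nat.descFactorial_of_lt (by omega : S.card - 2 < r)]
        simp
    · have hje : j ≠ e := by
        rintro rfl
        simp [he] at hjx
      have hjS' : j ∈ S.erase e := Finset.mem_erase.2 ⟨hje, hjS⟩
      have hcard : ((S.erase e).erase j).card = S.card - 2 := by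
        rw [Finset.card_erase_of_mem hjS', Finset.card_erase_of_mem heS]
        omega
      have hpair : (S.card - 2).descFactorial r ≤
          missCount g x₀ r (S.erase e) x + missCount g x₀ r (S.erase j) (g j • x) := by
        rw [← hcard]
        exact (descFactorial_le_missCount_add g x₀ r _ hjx.symm).trans (Nat.add_le_add
          (missCount_mono g x₀ r (Finset.erase_subset _ _) _)
          (missCount_mono g x₀ r (Finset.erase_subset_erase _ (Finset.erase_subset _ _)) _))
      have hrest : r * (S.card - 2).descFactorial r ≤
          ∑ c ∈ (S.erase e).erase j, missCount g x₀ r (S.erase c) (g c • x) := by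
        have : r * (S.card - 2).descFactorial r =
            (S.card - 2) * (r * (S.card - 3).descFactorial (r - 1)) := by
          cases r with
          | zero => simp
          | succ r =>
            rw [Nat.add_sub_cancel, ← mul_pred_descFactorial, Nat.sub_sub]
            ring
        rw [this, ← hcard, ← smul_eq_mul]
        refine Finset.card_nsmul_le_sum _ _ _ fun c hcS => ?_
        simp only [Finset.mem_erase] at hcS
        obtain ⟨hcj, hce, hcS⟩ := hcS
        have := ih (Finset.mem_erase.2 ⟨hce.symm, heS⟩) (hc c hcS hcj)
        rwa [Finset.card_erase_of_mem hcS, Nat.sub_sub] at this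
      rw [missCount, ← Finset.add_sum_erase _ _ heS, ← Finset.add_sum_erase _ _ hjS', he, one_smul]
      linarith

end MissCount

/-- Pak's lemma, generalized: if `G` is a finite group generated by
`g 0, …, g (k-1)` with `g 0 = 1`, `K` is a proper subgroup, and
`p = (l(l-1)+(k-l)(k-l-1))/(k(k-1))`, then a uniformly random injective
`l`-tuple `u` satisfies `g_u ∉ K` with probability at least `(1-p)/2`. -/
theorem prob_prod_not_mem_proper_subgroup {G : Type*} [Group G] [Fintype G]
    {k l : ℕ} (hl : 1 ≤ l) (hlk : l ≤ k)
    (g : Fin k → G) (hgen : Subgroup.closure (Set.range g) = ⊤)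
    (hid : g ⟨0, by omega⟩ = 1)
    (K : Subgroup G) (hK : K ≠ ⊤) :
    (1 - ((l : ℝ) * (l - 1) + ((k : ℝ) - l) * ((k : ℝ) - l - 1)) /
          ((k : ℝ) * (k - 1))) / 2 ≤
      (Nat.card {u : Fin l → Fin k // Function.Injective u ∧
          (List.ofFn (fun i => g (u i))).prod ∉ K} : ℝ) /
        (Nat.card {u : Fin l → Fin k // Function.Injective u} : ℝ) := by
  classical
  have hex : ∃ c, g c ∉ K := by
    by_contra! h
    refine hK (top_le_iff.1 (hgen ▸ (Subgroup.closure_le K).2 ?_))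
    rintro _ ⟨c, rfl⟩
    exact h c
  obtain ⟨c, hc⟩ := hex
  have hk : 2 ≤ k := by
    have : c ≠ ⟨0, by omega⟩ := by
      rintro rfl
      exact hc (hid ▸ K.one_mem)
    have := Fin.val_ne_of_ne this
    have := c.2
    simp only at *
    omega
  have hmem (a : G) : a • ((1 : G) : G ⧸ K) = ((1 : G) : G ⧸ K) ↔ a ∈ K := by
    rw [MulAction.Quotient.smul_coe, smul_eq_mul, mul_one, eq_comm, QuotientGroup.eq]
    simp
  have hmiss := mul_descFactorial_le_missCount g ((1 : G) : G ⧸ K) hid l (Finset.mem_univ _)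
    (x := ((1 : G) : G ⧸ K)) (.inr ⟨c, Finset.mem_univ _, fun h => hc ((hmem _).1 h)⟩)
  rw [missCount_eq_card] at hmiss
  simp only [ne_eq, hmem, Finset.mem_univ, implies_true, and_true, Finset.card_univ,
    Fintype.card_fin] at hmiss
  have hcard : Nat.card {u : Fin l → Fin k // Function.Injective u} = k.descFactorial l := by
    rw [Nat.card_congr (Equiv.subtypeInjectiveEquivEmbedding _ _), Nat.card_eq_fintype_card,
      Fintype.card_embedding_eq, Fintype.card_fin, Fintype.card_fin]
  have hpos : 0 < k.descFactorial l := Nat.descFactorial_pos.2 hlk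
  rw [hcard, le_div_iff₀ (by exact_mod_cast hpos)]
  refine le_trans (le_of_eq ?_) (Nat.cast_le.2 hmiss)
  obtain ⟨n, rfl⟩ := Nat.exists_eq_add_of_le' hk
  obtain ⟨m, rfl⟩ := Nat.exists_eq_add_of_le' hl
  have hrec : ((n + 1 - m : ℕ) : ℝ) * ((n + 1).descFactorial m : ℝ) =
      (n + 1) * (n.descFactorial m : ℝ) := by
    exact_mod_cast Nat.succ_descFactorial n m
  rw [Nat.cast_sub (by omega)] at hrec
  rw [Nat.succ_descFactorial_succ]
  simp only [Nat.add_sub_cancel]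
  push_cast at hrec ⊢
  rw [show (n : ℝ) + 2 - 1 = n + 1 by ring]
  field_simp
  linear_combination (2 * (m + 1 : ℝ) * (n + 2)) * hrec
end

section
/- Let G be a finite non-abelian group with generators g_1,...,g_k where g_1 is the identity. With S_l and g_u as before and p = (l(l-1)+(k-l)(k-l-1))/(k(k-1)), the probability over independent uniform u, v ∈ S_l that g_u g_v ≠ g_v g_u is at least (1-p)²/4. -/
open Finset in
/-- The orbit map of a transitive action of a finite group has fibres of constant size. -/
theorem card_filter_smul_mem_mul_card {P X : Type*} [Group P] [Fintype P] [Fintype X]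
    [DecidableEq X] [MulAction P X] [MulAction.IsPretransitive P X] (w : X) (B : Finset X) :
    #{σ : P | σ • w ∈ B} * Fintype.card X = #B * Fintype.card P := by
  have hfib : ∀ u : X, #{σ : P | σ • w = u} = #{σ : P | σ • w = w} := by
    intro u
    obtain ⟨τ, rfl⟩ := MulAction.exists_smul_eq P w u
    refine card_bij (fun σ _ => τ⁻¹ * σ) ?_ ?_ ?_
    · intro σ hσ
      simp_all [mul_smul]
    · intro σ _ σ' _ h
      simpa using h
    · intro σ hσ
      exact ⟨τ * σ, by simp_all [mul_smul], by simp⟩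
  have hcount : ∀ C : Finset X, #{σ : P | σ • w ∈ C} = #C * #{σ : P | σ • w = w} := by
    intro C
    rw [card_eq_sum_card_fiberwise (f := fun σ : P => σ • w) (t := C) (by intro σ; simp),
      ← smul_eq_mul, ← sum_const]
    refine sum_congr rfl fun u hu => ?_
    rw [← hfib u, filter_filter]
    congr 1
    ext σ
    simp only [mem_filter, mem_univ, true_and, and_iff_right_iff_imp]
    rintro rfl
    exact hu
  have huniv := hcount univ
  simp only [mem_univ, filter_true, card_univ] at huniv
  rw [hcount B, huniv]
  ring

/-- Some `i` in the list `L` has the property that inserting `i` into a set avoiding it changes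
whether the corresponding subproduct of `L` is in `K`, unless both are outside `K`. -/
theorem exists_insert_prod_notMem {G α : Type*} [Group G] [DecidableEq α] (K : Subgroup G)
    (f : α → G) (L : List α) (hL : L.Nodup) (hf : ∃ i ∈ L, f i ∉ K) :
    ∃ i, f i ∉ K ∧ ∀ B : Finset α, i ∉ B →
      (L.map fun j => if j ∈ B then f j else 1).prod ∈ K →
      (L.map fun j => if j ∈ insert i B then f j else 1).prod ∉ K := by
  induction L with
  | nil => simp at hf
  | cons x L ih =>
    rw [List.nodup_cons] at hL
    by_cases hx : f x ∈ K
    · obtain ⟨i, hi, h⟩ := ih hL.2 (by simpa [hx] using hf)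
      refine ⟨i, hi, fun B hB => ?_⟩
      have hmem : ∀ C : Finset α, (if x ∈ C then f x else 1) ∈ K := by
        intro C
        split_ifs
        exacts [hx, K.one_mem]
      rw [List.map_cons, List.map_cons, List.prod_cons, List.prod_cons,
        K.mul_mem_cancel_left (hmem _), K.mul_mem_cancel_left (hmem _)]
      exact h B hB
    · refine ⟨x, hx, fun B hB hP hP' => hx ?_⟩
      have hcongr : (L.map fun j => if j ∈ insert x B then f j else 1) =
          L.map fun j => if j ∈ B then f j else 1 := by
        refine List.map_congr_left fun j hj => ?_
        have : j ≠ x := fun h => hL.1 (h ▸ hj)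
        simp [this]
      simp only [List.map_cons, List.prod_cons, hB, if_false, one_mul,
        Finset.mem_insert_self, if_true, hcongr] at hP hP'
      exact (K.mul_mem_cancel_right hP).1 hP'

/-- The product of `f` along the increasing enumeration of `A`. -/
theorem prod_ofFn_orderEmbOfFin {M : Type*} [Monoid M] {k l : ℕ} (f : Fin k → M)
    (A : Finset (Fin k)) (hA : A.card = l) :
    (List.ofFn fun i => f (A.orderEmbOfFin hA i)).prod =
      ((List.finRange k).map fun j => if j ∈ A then f j else 1).prod := by
  have hlist : List.ofFn (A.orderEmbOfFin hA) = (List.finRange k).filter (· ∈ A) := by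
    refine List.Perm.eq_of_pairwise' (r := (· ≤ ·)) ?_ ?_ ?_
    · exact (List.pairwise_ofFn.2 fun i j hij => (A.orderEmbOfFin hA).monotone hij.le)
    · exact ((List.pairwise_le_finRange k).filter _)
    · rw [List.perm_ext_iff_of_nodup (List.nodup_ofFn.2 (A.orderEmbOfFin hA).injective)
        ((List.nodup_finRange k).filter _)]
      intro j
      rw [List.mem_ofFn', Finset.range_orderEmbOfFin]
      simp
  have hfilter : ∀ L : List (Fin k), ((L.filter (· ∈ A)).map f).prod =
      (L.map fun j => if j ∈ A then f j else 1).prod := by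
    intro L
    induction L with
    | nil => simp
    | cons x L ih => by_cases hx : x ∈ A <;> simp [hx, ih]
  rw [← hfilter, ← hlist, List.map_ofFn]
  rfl

open Finset in
/-- Among the `l`-subsets of `Fin k`, at least `(k - 2).choose (l - 1)` have their ordered product
outside `K`, provided that some factor is `1` and some factor is not in `K`. -/
theorem choose_le_card_prod_notMem {G : Type*} [Group G] {k l : ℕ} (hl : 1 ≤ l)
    (K : Subgroup G) [DecidablePred (· ∈ K)] (f : Fin k → G) (z : Fin k) (hz : f z = 1)
    (hf : ∃ i, f i ∉ K) :
    (k - 2).choose (l - 1) ≤ #{A ∈ powersetCard l (univ : Finset (Fin k)) |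
      ((List.finRange k).map fun j => if j ∈ A then f j else 1).prod ∉ K} := by
  obtain ⟨i, hi, h⟩ := exists_insert_prod_notMem K f (List.finRange k) (List.nodup_finRange k)
    (by simpa using hf)
  have hiz : i ≠ z := by
    rintro rfl
    exact hi (hz ▸ K.one_mem)
  have hins : ∀ B : Finset (Fin k),
      ((List.finRange k).map fun j => if j ∈ insert z B then f j else 1) =
        (List.finRange k).map fun j => if j ∈ B then f j else 1 := by
    intro B
    refine List.map_congr_left fun j _ => ?_
    by_cases hj : j = z
    · subst hj; simp [hz]
    · simp [hj]
  set S : Finset (Fin k) := (univ.erase i).erase z with hS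
  have hScard : #S = k - 2 := by
    rw [hS, card_erase_of_mem (by simp [hiz.symm]), card_erase_of_mem (mem_univ _), card_univ,
      Fintype.card_fin]
    omega
  rw [← hScard, ← card_powersetCard]
  refine card_le_card_of_injOn
    (fun B => if ((List.finRange k).map fun j => if j ∈ B then f j else 1).prod ∈ K
      then insert i B else insert z B) ?_ ?_
  · intro B hB
    obtain ⟨hBS, hBc⟩ := mem_powersetCard.1 hB
    have hiB : i ∉ B := fun hmem => by simpa [hS] using hBS hmem
    have hzB : z ∉ B := fun hmem => by simpa [hS] using hBS hmem
    simp only [coe_filter, Set.mem_ofPred_eq, mem_powersetCard, subset_univ, true_and]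
    split_ifs with hK
    · exact ⟨by rw [card_insert_of_notMem hiB]; omega, h B hiB hK⟩
    · exact ⟨by rw [card_insert_of_notMem hzB]; omega, by rwa [hins]⟩
  · intro B hB B' hB' heq
    have hrec : ∀ C ∈ powersetCard (l - 1) S, ∀ p : Prop, [Decidable p] →
        (if p then insert i C else insert z C) ∩ S = C := by
      intro C hC p _
      have hCS := (mem_powersetCard.1 hC).1
      have hiS : i ∉ S := by simp [hS]
      have hzS : z ∉ S := by simp [hS]
      split_ifs
      · rw [insert_inter_of_notMem hiS, inter_eq_left.2 hCS]
      · rw [insert_inter_of_notMem hzS, inter_eq_left.2 hCS]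
    rw [← hrec B hB (((List.finRange k).map fun j => if j ∈ B then f j else 1).prod ∈ K),
      ← hrec B' hB' (((List.finRange k).map fun j => if j ∈ B' then f j else 1).prod ∈ K)]
    exact congrArg (· ∩ S) heq

open Finset in
/-- The number of injective `l`-tuples whose product avoids a subgroup `K` not containing all
the `g i`. -/
theorem choose_mul_card_le_card_prod_notMem {G : Type*} [Group G] {k l : ℕ} (hl : 1 ≤ l)
    (K : Subgroup G) [DecidablePred (· ∈ K)] (g : Fin k → G) (z : Fin k) (hz : g z = 1)
    (hg : ∃ i, g i ∉ K) :
    (k - 2).choose (l - 1) * Fintype.card (Fin l ↪ Fin k) ≤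
      k.choose l * #{u : Fin l ↪ Fin k | (List.ofFn fun i => g (u i)).prod ∉ K} := by
  set B : Finset (Fin l ↪ Fin k) := {u | (List.ofFn fun i => g (u i)).prod ∉ K} with hB
  have : MulAction.IsPretransitive (Equiv.Perm (Fin k)) (Fin l ↪ Fin k) :=
    Equiv.Perm.isMultiplyPretransitive (Fin k) l
  let w : powersetCard l (univ : Finset (Fin k)) → (Fin l ↪ Fin k) :=
    fun A => (A.1.orderEmbOfFin (mem_powersetCard.1 A.2).2).toEmbedding
  have hle : ∀ σ : Equiv.Perm (Fin k), (k - 2).choose (l - 1) ≤ #{A | σ • w A ∈ B} := by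
    intro σ
    obtain ⟨i, hi⟩ := hg
    refine (choose_le_card_prod_notMem hl K (g ∘ σ) (σ.symm z) (by simpa using hz)
      ⟨σ.symm i, by simpa using hi⟩).trans ?_
    refine card_le_card_of_surjOn Subtype.val ?_
    intro A hA
    obtain ⟨hA, hP⟩ := mem_filter.1 (mem_coe.1 hA)
    refine ⟨⟨A, hA⟩, ?_, rfl⟩
    rw [← prod_ofFn_orderEmbOfFin (g ∘ σ) A (mem_powersetCard.1 hA).2] at hP
    simpa [hB, w] using hP
  have hdouble : ∑ σ : Equiv.Perm (Fin k), #{A | σ • w A ∈ B} =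
      ∑ A, #{σ : Equiv.Perm (Fin k) | σ • w A ∈ B} :=
    sum_card_bipartiteAbove_eq_sum_card_bipartiteBelow (fun σ A => σ • w A ∈ B)
  have hsum : (∑ σ : Equiv.Perm (Fin k), #{A | σ • w A ∈ B}) * Fintype.card (Fin l ↪ Fin k) =
      k.choose l * (#B * Fintype.card (Equiv.Perm (Fin k))) := by
    rw [hdouble, sum_mul]
    simp_rw [card_filter_smul_mem_mul_card]
    simp
  have hlow : Fintype.card (Equiv.Perm (Fin k)) * (k - 2).choose (l - 1) ≤
      ∑ σ : Equiv.Perm (Fin k), #{A | σ • w A ∈ B} := by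
    simpa using card_nsmul_le_sum univ _ _ fun σ _ => hle σ
  refine Nat.le_of_mul_le_mul_left ?_ (Fintype.card_pos (α := Equiv.Perm (Fin k)))
  calc _ = Fintype.card (Equiv.Perm (Fin k)) * (k - 2).choose (l - 1) *
        Fintype.card (Fin l ↪ Fin k) := by ring
    _ ≤ _ := Nat.mul_le_mul_right _ hlow
    _ = _ := by rw [hsum]; ring

theorem Nat.mul_choose_sub_two_eq {k l : ℕ} (hl : 1 ≤ l) (hlk : l ≤ k) (hk : 2 ≤ k) :
    k * (k - 1) * (k - 2).choose (l - 1) = l * (k - l) * k.choose l := by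
  obtain ⟨m, rfl⟩ := Nat.exists_eq_add_of_le' hk
  obtain ⟨j, rfl⟩ := Nat.exists_eq_add_of_le' hl
  have h₁ := Nat.add_one_mul_choose_eq (m + 1) j
  have h₂ := Nat.choose_mul_succ_eq m j
  rw [show m + 2 - 1 = m + 1 by omega, show m + 2 - 2 = m by omega, show j + 1 - 1 = j by omega,
    show m + 2 - (j + 1) = m + 1 - j by omega]
  calc (m + 2) * (m + 1) * m.choose j = (m + 2) * (m.choose j * (m + 1)) := by ring
    _ = (m + 1 + 1) * (m + 1).choose j * (m + 1 - j) := by rw [h₂]; ring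
    _ = _ := by rw [h₁]; ring

open Finset in
/-- A random injective `l`-tuple has product outside a proper subgroup `K` with probability at
least `l (k - l) / (k (k - 1))`. -/
theorem mul_card_le_card_prod_notMem {G : Type*} [Group G] {k l : ℕ} (hl : 1 ≤ l) (hlk : l ≤ k)
    (g : Fin k → G) (hgen : Subgroup.closure (Set.range g) = ⊤) (z : Fin k) (hz : g z = 1)
    (K : Subgroup G) [DecidablePred (· ∈ K)] (hK : K ≠ ⊤) :
    (l * (k - l) / (k * (k - 1)) : ℝ) * Fintype.card (Fin l ↪ Fin k) ≤
      #{u : Fin l ↪ Fin k | (List.ofFn fun i => g (u i)).prod ∉ K} := by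
  have hg : ∃ i, g i ∉ K := by
    by_contra! h
    refine hK (top_le_iff.1 (hgen ▸ (Subgroup.closure_le K).2 ?_))
    rintro _ ⟨i, rfl⟩
    exact h i
  have hk : 2 ≤ k := by
    obtain ⟨i, hi⟩ := hg
    have hiz : i ≠ z := by
      rintro rfl
      exact hi (hz ▸ K.one_mem)
    have := Fin.val_ne_of_ne hiz
    omega
  have hle := choose_mul_card_le_card_prod_notMem hl K g z hz hg
  have hid := Nat.mul_choose_sub_two_eq hl hlk hk
  have hkl : (0 : ℝ) < k.choose l := by exact_mod_cast Nat.choose_pos hlk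
  have hk' : (2 : ℝ) ≤ k := by exact_mod_cast hk
  have hpos : (0 : ℝ) < k * (k - 1) := by nlinarith
  have hleR : ((k - 2).choose (l - 1) : ℝ) * Fintype.card (Fin l ↪ Fin k) ≤
      k.choose l * #{u : Fin l ↪ Fin k | (List.ofFn fun i => g (u i)).prod ∉ K} := by
    exact_mod_cast hle
  have hidR : (k * (k - 1) * (k - 2).choose (l - 1) : ℝ) = l * (k - l) * k.choose l := by
    have := congrArg (Nat.cast (R := ℝ)) hid
    push_cast [Nat.cast_sub hlk, Nat.cast_sub (show 1 ≤ k by omega)] at this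
    exact this
  have hratio : (l * (k - l) / (k * (k - 1)) : ℝ) = (k - 2).choose (l - 1) / k.choose l := by
    rw [div_eq_div_iff hpos.ne' hkl.ne']
    linarith
  rw [hratio, div_mul_eq_mul_div, div_le_iff₀ hkl]
  linarith

open Finset in
theorem card_injective_pairs_not_commute {G ι κ : Type*} [Group G] [Fintype ι] [Fintype κ]
    [DecidableEq ι] [DecidableEq κ] (Q : (ι → κ) → G)
    [∀ a : G, DecidablePred (· ∈ Subgroup.centralizer {a})] :
    Nat.card {uv : (ι → κ) × (ι → κ) //
      Function.Injective uv.1 ∧ Function.Injective uv.2 ∧ Q uv.1 * Q uv.2 ≠ Q uv.2 * Q uv.1} =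
      ∑ u : ι ↪ κ, #{v : ι ↪ κ | Q v ∉ Subgroup.centralizer {Q u}} := by
  let e : {uv : (ι → κ) × (ι → κ) //
      Function.Injective uv.1 ∧ Function.Injective uv.2 ∧ Q uv.1 * Q uv.2 ≠ Q uv.2 * Q uv.1} ≃
      Σ u : ι ↪ κ, {v : ι ↪ κ // Q v ∉ Subgroup.centralizer {Q u}} :=
    { toFun := fun x => ⟨⟨x.1.1, x.2.1⟩, ⟨x.1.2, x.2.2.1⟩, fun h =>
        x.2.2.2 (Subgroup.mem_centralizer_singleton_iff.1 h).symm⟩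
      invFun := fun y => ⟨(y.1, y.2.1), y.1.injective, y.2.1.injective, fun h =>
        y.2.2 (Subgroup.mem_centralizer_singleton_iff.2 h.symm)⟩
      left_inv := fun _ => rfl
      right_inv := fun _ => rfl }
  rw [Nat.card_congr e, Nat.card_sigma]
  exact sum_congr rfl fun u _ => by rw [Nat.card_eq_fintype_card, Fintype.card_subtype]

/-- If `G` is a finite non-abelian group generated by `g 0, …, g (k-1)` with
`g 0 = 1`, then for independent uniformly random injective `l`-tuples `u, v`,
the products `g_u` and `g_v` fail to commute with probability at least
`(1-p)²/4`, where `p = (l(l-1)+(k-l)(k-l-1))/(k(k-1))`. -/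
theorem prob_noncommuting_products {G : Type*} [Group G] [Fintype G]
    {k l : ℕ} (hl : 1 ≤ l) (hlk : l ≤ k)
    (g : Fin k → G) (hgen : Subgroup.closure (Set.range g) = ⊤)
    (hid : g ⟨0, by omega⟩ = 1)
    (hna : ∃ a b : G, a * b ≠ b * a) :
    (1 - ((l : ℝ) * (l - 1) + ((k : ℝ) - l) * ((k : ℝ) - l - 1)) /
          ((k : ℝ) * (k - 1))) ^ 2 / 4 ≤
      (Nat.card {uv : (Fin l → Fin k) × (Fin l → Fin k) //
          Function.Injective uv.1 ∧ Function.Injective uv.2 ∧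
          (List.ofFn (fun i => g (uv.1 i))).prod * (List.ofFn (fun i => g (uv.2 i))).prod ≠
            (List.ofFn (fun i => g (uv.2 i))).prod * (List.ofFn (fun i => g (uv.1 i))).prod} : ℝ) /
        ((Nat.card {u : Fin l → Fin k // Function.Injective u} : ℝ) ^ 2) := by
  classical
  set q : ℝ := l * (k - l) / (k * (k - 1)) with hq
  let Q : (Fin l → Fin k) → G := fun u => (List.ofFn fun i => g (u i)).prod
  set n : ℕ := Fintype.card (Fin l ↪ Fin k) with hn
  have hbound := fun (K : Subgroup G) [DecidablePred (· ∈ K)] (hK : K ≠ ⊤) =>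
    mul_card_le_card_prod_notMem hl hlk g hgen _ hid K hK
  have hcenter : Subgroup.center G ≠ ⊤ := by
    obtain ⟨a, b, hab⟩ := hna
    intro h
    exact hab ((Subgroup.mem_center_iff.1 (h ▸ Subgroup.mem_top b)) a)
  have hk : (2 : ℝ) ≤ k := by
    by_contra! hlt
    have hk1 : k = 1 := by
      have : k < 2 := by exact_mod_cast hlt
      omega
    subst hk1
    refine hcenter (top_le_iff.1 (hgen ▸ (Subgroup.closure_le _).2 ?_))
    rintro _ ⟨i, rfl⟩
    rw [Subsingleton.elim i ⟨0, by omega⟩, hid]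
    exact Subgroup.one_mem _
  have hlk' : (l : ℝ) ≤ k := by exact_mod_cast hlk
  have hpos : (0 : ℝ) < k * (k - 1) := by nlinarith
  have hq0 : 0 ≤ q := div_nonneg (mul_nonneg l.cast_nonneg (by linarith)) hpos.le
  have hp : (1 - ((l : ℝ) * (l - 1) + ((k : ℝ) - l) * ((k : ℝ) - l - 1)) /
      ((k : ℝ) * (k - 1))) ^ 2 / 4 = q ^ 2 := by
    have : 1 - ((l : ℝ) * (l - 1) + ((k : ℝ) - l) * ((k : ℝ) - l - 1)) /
        ((k : ℝ) * (k - 1)) = 2 * q := by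
      rw [hq, ← mul_div_assoc, eq_div_iff hpos.ne', sub_mul, div_mul_cancel₀ _ hpos.ne']
      ring
    rw [this]
    ring
  have hcardX : Nat.card {u : Fin l → Fin k // Function.Injective u} = n := by
    rw [hn, ← Nat.card_eq_fintype_card]
    exact Nat.card_congr (Equiv.subtypeInjectiveEquivEmbedding _ _)
  have hn0 : (0 : ℝ) < n := by
    have : Nonempty (Fin l ↪ Fin k) := ⟨Fin.castLEEmb hlk⟩
    exact_mod_cast Fintype.card_pos (α := Fin l ↪ Fin k)
  rw [hp, hcardX, le_div_iff₀ (by positivity)]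
  refine le_of_le_of_eq ?_
    (congrArg (Nat.cast (R := ℝ)) (card_injective_pairs_not_commute Q)).symm
  push_cast
  let S : Finset (Fin l ↪ Fin k) := {u : Fin l ↪ Fin k | Q u ∉ Subgroup.center G}
  calc q ^ 2 * (n : ℝ) ^ 2 = (q * n) * (q * n) := by ring
    _ ≤ S.card * (q * n) :=
        mul_le_mul_of_nonneg_right (hbound _ hcenter) (by positivity)
    _ = ∑ u ∈ S, q * n := by simp
    _ ≤ ∑ u ∈ S,
          (({v : Fin l ↪ Fin k | Q v ∉ Subgroup.centralizer {Q u}} : Finset _).card : ℝ) := by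
        refine Finset.sum_le_sum fun u hu => hbound _ fun htop => (Finset.mem_filter.1 hu).2 ?_
        simpa using Subgroup.centralizer_eq_top_iff_subset.1 htop
    _ ≤ _ := Finset.sum_le_sum_of_subset_of_nonneg (Finset.filter_subset _ _) fun _ _ _ =>
        by positivity
end
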